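/- arXiv:1607.00956 — 3 statements merged into one kernel-verified Lean document; each statement's English description precedes it below -/
import Mathlib

section
/- Let Δ be a convex set of probability distributions on X and suppose q0 ∈ Δ minimizes the dissipation functional W_d over Δ. Then for every r0 ∈ Δ satisfying r0(x) = 0 whenever q0(x) = 0, one has W_d(r0) − W_d(q0) ≥ D(r0‖q0) − D(r0P‖q0P). -/
open Finset

/-- `p` is a probability distribution on the finite set `X`. -/
def IsProb {X : Type*} [Fintype X] (p : X → ℝ) : Prop :=
  (∀ x, 0 ≤ p x) ∧ ∑ x, p x = 1

/-- `P` is a row-stochastic kernel on `X`; `P x0 x1` denotes `P(x1|x0)`. -/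
def IsKernel {X : Type*} [Fintype X] (P : X → X → ℝ) : Prop :=
  (∀ x0 x1, 0 ≤ P x0 x1) ∧ ∀ x0, ∑ x1, P x0 x1 = 1

/-- Push-forward of `p` under the kernel `P`: `(pP)(x1) = Σ_{x0} p(x0) P(x1|x0)`. -/
def push {X : Type*} [Fintype X] (P : X → X → ℝ) (p : X → ℝ) : X → ℝ :=
  fun x1 => ∑ x0, p x0 * P x0 x1

/-- Shannon entropy with natural logarithm (`Real.log 0 = 0` gives the `0 ln 0 = 0` convention). -/
noncomputable def shannon {X : Type*} [Fintype X] (p : X → ℝ) : ℝ :=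
  -∑ x, p x * Real.log (p x)

/-- Dissipation functional `W_d(p) = S(pP) − S(p) − Σ_x p(x) Q(x)`. -/
noncomputable def Wd {X : Type*} [Fintype X] (P : X → X → ℝ) (Q : X → ℝ) (p : X → ℝ) : ℝ :=
  shannon (push P p) - shannon p - ∑ x, p x * Q x

/-- Kullback–Leibler divergence `D(r‖q) = Σ_x r(x) ln(r(x)/q(x))`
(terms with `r x = 0` vanish since `0 * log _ = 0`). -/
noncomputable def KL {X : Type*} [Fintype X] (r q : X → ℝ) : ℝ :=
  ∑ x, r x * Real.log (r x / q x)

open Filter Topology in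
lemma HasDerivAt.nonneg_of_forall_le {f : ℝ → ℝ} {L : ℝ} (hf : HasDerivAt f L 0)
    (hmin : ∀ t ∈ Set.Ioo (0 : ℝ) 1, f 0 ≤ f t) : 0 ≤ L := by
  have hslope : Tendsto (slope f 0) (𝓝[>] 0) (𝓝 L) :=
    (hasDerivAt_iff_tendsto_slope.1 hf).mono_left
      (nhdsWithin_mono _ fun t (ht : 0 < t) => ne_of_gt ht)
  refine ge_of_tendsto hslope ?_
  filter_upwards [Ioo_mem_nhdsGT (zero_lt_one (α := ℝ))] with t ht
  rw [slope_def_field]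
  exact div_nonneg (sub_nonneg.2 (hmin t ht)) (by linarith [ht.1])

lemma hasDerivAt_shannon_segment {X : Type*} [Fintype X] {r q : X → ℝ}
    (habs : ∀ x, q x = 0 → r x = 0) :
    HasDerivAt (fun t : ℝ => shannon (fun x => q x + t * (r x - q x)))
      (-∑ x, (r x - q x) * (Real.log (q x) + 1)) 0 := by
  unfold shannon
  refine (HasDerivAt.fun_sum fun x _ => ?_).neg
  by_cases hq : q x = 0
  · simpa [hq, habs x hq] using hasDerivAt_const (0 : ℝ) (0 : ℝ)
  · have hline : HasDerivAt (fun t : ℝ => q x + t * (r x - q x)) (r x - q x) 0 := by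
      simpa using ((hasDerivAt_id (0 : ℝ)).mul_const (r x - q x)).const_add (q x)
    have hlog : HasDerivAt (fun y : ℝ => y * Real.log y) (Real.log (q x) + 1)
        (q x + 0 * (r x - q x)) := by
      simpa using Real.hasDerivAt_mul_log hq
    rw [mul_comm (r x - q x)]
    exact hlog.comp (0 : ℝ) hline

lemma shannon_sub_shannon {X : Type*} [Fintype X] {r q : X → ℝ}
    (habs : ∀ x, q x = 0 → r x = 0) (hsum : ∑ x, r x = ∑ x, q x) :
    shannon r - shannon q = -∑ x, (r x - q x) * (Real.log (q x) + 1) - KL r q := by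
  have hterm : ∀ x, r x * Real.log (r x) - q x * Real.log (q x) =
      (r x - q x) * (Real.log (q x) + 1) + r x * Real.log (r x / q x) - (r x - q x) := by
    intro x
    by_cases hr : r x = 0
    · simp only [hr]
      ring
    · rw [Real.log_div hr (mt (habs x) hr)]
      ring
  have h := Finset.sum_congr (rfl : (Finset.univ : Finset X) = _) fun x _ => hterm x
  simp only [Finset.sum_sub_distrib, Finset.sum_add_distrib] at h
  unfold shannon KL
  linarith

lemma sum_push {X : Type*} [Fintype X] {P : X → X → ℝ} (hP : IsKernel P) (p : X → ℝ) :
    ∑ x, push P p x = ∑ x, p x := by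
  unfold push
  rw [Finset.sum_comm]
  simp [← Finset.mul_sum, hP.2]

lemma push_eq_zero_of_push_eq_zero {X : Type*} [Fintype X] {P : X → X → ℝ} (hP : IsKernel P)
    {r q : X → ℝ} (hq : ∀ x, 0 ≤ q x) (habs : ∀ x, q x = 0 → r x = 0) (y : X)
    (hy : push P q y = 0) : push P r y = 0 := by
  unfold push at hy ⊢
  rw [Finset.sum_eq_zero_iff_of_nonneg fun x _ => mul_nonneg (hq x) (hP.1 x y)] at hy
  refine Finset.sum_eq_zero fun x hx => ?_
  rcases mul_eq_zero.1 (hy x hx) with h | h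
  · rw [habs x h, zero_mul]
  · rw [h, mul_zero]

lemma push_segment {X : Type*} [Fintype X] (P : X → X → ℝ) (r q : X → ℝ) (t : ℝ) :
    push P (fun x => q x + t * (r x - q x)) =
      fun y => push P q y + t * (push P r y - push P q y) := by
  funext y
  simp only [push, ← Finset.sum_sub_distrib, Finset.mul_sum, ← Finset.sum_add_distrib]
  exact Finset.sum_congr rfl fun x _ => by ring

/-- If `q0` minimizes dissipation over a convex set `Δ` of probability
distributions, then for every `r0 ∈ Δ` absolutely continuous w.r.t. `q0`,
`W_d(r0) − W_d(q0) ≥ D(r0‖q0) − D(r0P‖q0P)`. -/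
theorem incorrect_prior_dissipation_convex_lower_bound {X : Type*} [Fintype X] [Nonempty X]
    (P : X → X → ℝ) (Q : X → ℝ) (hP : IsKernel P)
    (Δ : Set (X → ℝ)) (hΔprob : ∀ p ∈ Δ, IsProb p) (hΔconv : Convex ℝ Δ)
    (q0 : X → ℝ) (hq0 : q0 ∈ Δ)
    (hmin : ∀ p ∈ Δ, Wd P Q q0 ≤ Wd P Q p)
    (r0 : X → ℝ) (hr0 : r0 ∈ Δ) (habs : ∀ x, q0 x = 0 → r0 x = 0) :
    Wd P Q r0 - Wd P Q q0 ≥ KL r0 q0 - KL (push P r0) (push P q0) := by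
  have hq := hΔprob q0 hq0
  have hsum : ∑ x, r0 x = ∑ x, q0 x := by rw [(hΔprob r0 hr0).2, hq.2]
  have habs' := push_eq_zero_of_push_eq_zero hP hq.1 habs
  have hsum' : ∑ x, push P r0 x = ∑ x, push P q0 x := by rw [sum_push hP, sum_push hP, hsum]
  have hheat : HasDerivAt (fun t : ℝ => ∑ x, (q0 x + t * (r0 x - q0 x)) * Q x)
      (∑ x, (r0 x - q0 x) * Q x) 0 := by
    refine HasDerivAt.fun_sum fun x _ => ?_
    simpa using
      (((hasDerivAt_id (0 : ℝ)).mul_const (r0 x - q0 x)).const_add (q0 x)).mul_const (Q x)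
  have hderiv :=
    ((hasDerivAt_shannon_segment habs').sub (hasDerivAt_shannon_segment habs)).sub hheat
  have hWd : (fun t : ℝ => Wd P Q (fun x => q0 x + t * (r0 x - q0 x))) = _ :=
    funext fun t => by rw [Wd, push_segment]
  replace hderiv := hderiv.congr_of_eventuallyEq (Filter.EventuallyEq.of_eq hWd)
  have hnonneg := hderiv.nonneg_of_forall_le fun t ht => by
    have hmem : (fun x => q0 x + t * (r0 x - q0 x)) ∈ Δ :=
      hΔconv.add_smul_sub_mem hq0 hr0 ⟨ht.1.le, ht.2.le⟩
    simpa using hmin _ hmem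
  have hS := shannon_sub_shannon habs hsum
  have hS' := shannon_sub_shannon habs' hsum'
  have hQ : ∑ x, (r0 x - q0 x) * Q x = ∑ x, r0 x * Q x - ∑ x, q0 x * Q x := by
    simp only [sub_mul, Finset.sum_sub_distrib]
  unfold Wd
  linarith
end

section
/- Suppose the kernel P is strictly positive, i.e., P(x1|x0) > 0 for all x0, x1. Then every probability distribution q^V on V that minimizes the composed functional p^V ↦ W_d(Φ(p^V)) over all probability distributions on V has full support: q^V(v) > 0 for all v. -/
open Finset

/-- The push-forward of a probability distribution under a kernel is a probability distribution. -/
theorem IsProb.push {X : Type*} [Fintype X] {P : X → X → ℝ} {p : X → ℝ}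
    (hP : IsKernel P) (hp : IsProb p) : IsProb (push P p) := by
  refine ⟨fun x => sum_nonneg fun y _ => mul_nonneg (hp.1 y) (hP.1 y x), ?_⟩
  unfold _root_.push
  rw [sum_comm, ← hp.2]
  exact sum_congr rfl fun y _ => by rw [← mul_sum, hP.2 y, mul_one]

/-- A strictly positive kernel pushes every probability distribution to one of full support. -/
theorem push_pos {X : Type*} [Fintype X] {P : X → X → ℝ} {p : X → ℝ}
    (hPpos : ∀ x0 x1, 0 < P x0 x1) (hp : IsProb p) (x : X) : 0 < push P p x := by
  obtain ⟨y, -, hy⟩ : ∃ y ∈ univ, 0 < p y := by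
    by_contra! h
    have := hp.2 ▸ sum_nonpos h
    linarith
  exact sum_pos' (fun z _ => mul_nonneg (hp.1 z) (hPpos z x).le)
    ⟨y, mem_univ y, mul_pos hy (hPpos y x)⟩

theorem push_mix {X : Type*} [Fintype X] (P : X → X → ℝ) (p r : X → ℝ) (t : ℝ) (x : X) :
    push P (fun y => (1 - t) * p y + t * r y) x = (1 - t) * push P p x + t * push P r x := by
  simp only [push, mul_sum, ← sum_add_distrib]
  exact sum_congr rfl fun y _ => by ring

theorem IsProb.mix {X : Type*} [Fintype X] {p r : X → ℝ} (hp : IsProb p) (hr : IsProb r)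
    {t : ℝ} (h0 : 0 ≤ t) (h1 : t ≤ 1) : IsProb fun x => (1 - t) * p x + t * r x := by
  refine ⟨fun x => add_nonneg (mul_nonneg (sub_nonneg.2 h1) (hp.1 x)) (mul_nonneg h0 (hr.1 x)), ?_⟩
  rw [sum_add_distrib, ← mul_sum, ← mul_sum, hp.2, hr.2]
  ring

/-- Gibbs' inequality: entropy is at most cross entropy. -/
theorem shannon_le_cross_entropy {X : Type*} [Fintype X] {a b : X → ℝ}
    (ha : IsProb a) (hb : IsProb b) (hbpos : ∀ x, 0 < b x) :
    shannon a ≤ -∑ x, a x * Real.log (b x) := by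
  have key : ∀ x, a x * Real.log (b x) - a x * Real.log (a x) ≤ b x - a x := by
    intro x
    rcases (ha.1 x).eq_or_lt with h | h
    · simp [← h, (hbpos x).le]
    · have hlog := Real.log_le_sub_one_of_pos (div_pos (hbpos x) h)
      rw [Real.log_div (hbpos x).ne' h.ne'] at hlog
      have hmul := mul_le_mul_of_nonneg_left hlog h.le
      rw [mul_sub, mul_sub, mul_div_cancel₀ _ h.ne', mul_one] at hmul
      exact hmul
  have hsum := sum_le_sum fun x (_ : x ∈ univ) => key x
  rw [sum_sub_distrib, sum_sub_distrib, hb.2, ha.2] at hsum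
  unfold shannon
  linarith

/-- Entropy of a mixture of two distributions with disjoint supports, bounded below. -/
theorem le_shannon_mix {X : Type*} [Fintype X] {p r : X → ℝ} (hp : IsProb p) (hr : IsProb r)
    (hdisj : ∀ x, p x = 0 ∨ r x = 0) {t : ℝ} (h0 : 0 < t) (h1 : t < 1) :
    (1 - t) * shannon p + t * shannon r - t * Real.log t
      ≤ shannon fun x => (1 - t) * p x + t * r x := by
  have key : ∀ x, ((1 - t) * p x + t * r x) * Real.log ((1 - t) * p x + t * r x)
      ≤ (1 - t) * (p x * Real.log (p x)) + t * (r x * Real.log (r x))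
        + t * Real.log t * r x := by
    intro x
    rcases hdisj x with h | h
    · by_cases hx : r x = 0
      · simp [h, hx]
      · rw [h, mul_zero, zero_add, Real.log_mul h0.ne' hx]
        apply le_of_eq
        ring
    · by_cases hx : p x = 0
      · simp [h, hx]
      · rw [h, mul_zero, add_zero, Real.log_mul (sub_pos.2 h1).ne' hx]
        have hlog : Real.log (1 - t) ≤ 0 := Real.log_nonpos (by linarith) (by linarith)
        have := mul_nonpos_of_nonneg_of_nonpos
          (mul_nonneg (sub_pos.2 h1).le (hp.1 x)) hlog
        linarith
  have hsum := sum_le_sum fun x (_ : x ∈ univ) => key x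
  rw [sum_add_distrib, sum_add_distrib, ← mul_sum, ← mul_sum, ← mul_sum, hr.2] at hsum
  unfold shannon
  linarith

/-- For a strictly positive kernel, mixing in a small amount of a distribution with disjoint
support strictly lowers the dissipation. -/
theorem exists_Wd_mix_lt {X : Type*} [Fintype X] {P : X → X → ℝ} (Q : X → ℝ)
    (hP : IsKernel P) (hPpos : ∀ x0 x1, 0 < P x0 x1) {p r : X → ℝ} (hp : IsProb p)
    (hr : IsProb r) (hdisj : ∀ x, p x = 0 ∨ r x = 0) :
    ∃ t : ℝ, 0 < t ∧ t < 1 ∧ Wd P Q (fun x => (1 - t) * p x + t * r x) < Wd P Q p := by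
  set C := -∑ x, push P r x * Real.log (push P p x) with hC
  set K := C - shannon r - ∑ x, r x * Q x - Wd P Q p with hK
  have h0 : 0 < Real.exp (-(|K| + 1)) := Real.exp_pos _
  have h1 : Real.exp (-(|K| + 1)) < 1 := Real.exp_lt_one_iff.2 (by linarith [abs_nonneg K])
  refine ⟨Real.exp (-(|K| + 1)), h0, h1, ?_⟩
  have hlog : K + Real.log (Real.exp (-(|K| + 1))) < 0 := by
    rw [Real.log_exp]
    linarith [le_abs_self K]
  generalize Real.exp (-(|K| + 1)) = t at h0 h1 hlog ⊢
  have hS := le_shannon_mix hp hr hdisj h0 h1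
  have hG := shannon_le_cross_entropy ((hp.mix hr h0.le h1.le).push hP) (hp.push hP)
    (push_pos hPpos hp)
  have hcross : -∑ x, push P (fun y => (1 - t) * p y + t * r y) x * Real.log (push P p x)
      = (1 - t) * shannon (push P p) + t * C := by
    simp only [push_mix, add_mul, sum_add_distrib, mul_assoc, ← mul_sum, hC, shannon]
    ring
  have hQ : ∑ x, ((1 - t) * p x + t * r x) * Q x
      = (1 - t) * ∑ x, p x * Q x + t * ∑ x, r x * Q x := by
    simp only [add_mul, sum_add_distrib, mul_assoc, ← mul_sum]
  have hneg := mul_neg_of_pos_of_neg h0 hlog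
  rw [hcross] at hG
  rw [hK] at hneg
  simp only [Wd, hQ] at hneg ⊢
  linarith

/-- The microstate distribution induced by a macrostate distribution is a probability
distribution. -/
theorem IsProb.induced {X V : Type*} [Fintype X] [Fintype V] {g : X → V} {s : V → X → ℝ}
    (hs : ∀ v, IsProb (s v)) (hs0 : ∀ v x, g x ≠ v → s v x = 0) {q : V → ℝ} (hq : IsProb q) :
    IsProb fun x => q (g x) * s (g x) x := by
  refine ⟨fun x => mul_nonneg (hq.1 _) ((hs _).1 x), ?_⟩
  have h : ∀ x, q (g x) * s (g x) x = ∑ v, q v * s v x := fun x =>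
    by
    rw [sum_eq_single (g x) (fun v _ hv => by rw [hs0 v x hv.symm, mul_zero])]
    simp
  simp only [h]
  rw [sum_comm]
  simp only [← mul_sum, (hs _).2, mul_one, hq.2]

/-- If the kernel is strictly positive, then every minimizer of the
coarse-grained dissipation `p^V ↦ W_d(Φ(p^V))` over probability distributions on the
macrostates `V` has full support. -/
theorem coarse_grained_prior_full_support {X V : Type*} [Fintype X] [Nonempty X]
    [Fintype V] [Nonempty V]
    (P : X → X → ℝ) (Q : X → ℝ) (hP : IsKernel P)
    (hPpos : ∀ x0 x1, 0 < P x0 x1)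
    (g : X → V) (hg : Function.Surjective g)
    (s : V → X → ℝ) (hs : ∀ v, IsProb (s v)) (hs0 : ∀ v x, g x ≠ v → s v x = 0)
    (qV : V → ℝ) (hq : IsProb qV)
    (hmin : ∀ pV : V → ℝ, IsProb pV →
      Wd P Q (fun x => pV (g x) * s (g x) x) ≥ Wd P Q (fun x => qV (g x) * s (g x) x)) :
    ∀ v, 0 < qV v := by
  classical
  intro w
  by_contra hw
  have hw0 : qV w = 0 := le_antisymm (not_lt.1 hw) (hq.1 w)
  have hδ : IsProb (Pi.single w 1 : V → ℝ) :=
    ⟨fun v => (Pi.single_nonneg.2 zero_le_one : (0 : V → ℝ) ≤ Pi.single w 1) v, by simp⟩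
  obtain ⟨t, h0, h1, hlt⟩ := exists_Wd_mix_lt Q hP hPpos (hq.induced hs hs0)
    (hδ.induced hs hs0) fun x => by
      by_cases hx : g x = w
      · exact Or.inl (by rw [hx, hw0, zero_mul])
      · exact Or.inr (by rw [Pi.single_eq_of_ne hx, zero_mul])
  have hge := hmin _ (hq.mix hδ h0.le h1.le)
  simp only [add_mul, mul_assoc] at hge
  exact hge.not_gt hlt
end

section
/- Let P be a row-stochastic kernel on the finite set X and let q be a probability distribution on X with full support. Then there exists a probability distribution r on X with D(r‖q) − D(rP‖qP) > 0 if and only if P is not a permutation kernel, i.e., there is no bijection σ : X → X such that P(x1|x0) = 1 when x1 = σ(x0) and P(x1|x0) = 0 otherwise. In particular, if P is a permutation kernel then D(rP‖qP) = D(r‖q) for every probability distribution r. -/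
open Finset

theorem push_single {X : Type*} [Fintype X] [DecidableEq X] (P : X → X → ℝ) (a : X) :
    push P (Pi.single a 1) = P a := by
  ext b
  simp [push, Pi.single_apply]

theorem isProb_single {X : Type*} [Fintype X] [DecidableEq X] (a : X) :
    IsProb (Pi.single a 1 : X → ℝ) := by
  refine ⟨fun x => ?_, by simp⟩
  rw [Pi.single_apply]
  split_ifs <;> norm_num

theorem KL_single {X : Type*} [Fintype X] [DecidableEq X] (q : X → ℝ) (a : X) :
    KL (Pi.single a 1) q = -Real.log (q a) := by
  rw [KL, Finset.sum_eq_single a]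
  · simp
  · intro b _ hb
    simp [hb]
  · simp

/-- A permutation kernel preserves Kullback–Leibler divergence. -/
theorem KL_push_of_perm {X : Type*} [Fintype X] [DecidableEq X] {P : X → X → ℝ}
    (σ : Equiv.Perm X) (h : ∀ x0 x1, P x0 x1 = if x1 = σ x0 then 1 else 0) (r q : X → ℝ) :
    KL (push P r) (push P q) = KL r q := by
  have hpush : ∀ (p : X → ℝ) (x : X), push P p (σ x) = p x := by
    intro p x
    simp [push, h]
  unfold KL
  rw [← Equiv.sum_comp σ]
  simp [hpush]

/-- If the rows of `P` at two distinct points charge a common point, then a point mass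
contracts strictly. -/
theorem KL_push_single_lt {X : Type*} [Fintype X] [DecidableEq X] {P : X → X → ℝ}
    (hP : IsKernel P) {q : X → ℝ} (hq : ∀ x, 0 < q x) {a a' b : X} (hne : a ≠ a')
    (hab : 0 < P a b) (hab' : 0 < P a' b) :
    KL (push P (Pi.single a 1)) (push P q) < KL (Pi.single a 1) q := by
  have hnonneg : ∀ c x, 0 ≤ q x * P x c := fun c x => mul_nonneg (hq x).le (hP.1 x c)
  have hle : ∀ c, q a * P a c ≤ push P q c := fun c =>
    Finset.single_le_sum (f := fun x => q x * P x c) (fun x _ => hnonneg c x)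
      (Finset.mem_univ a)
  have hlt : q a * P a b < push P q b :=
    Finset.single_lt_sum (f := fun x => q x * P x b) hne.symm (Finset.mem_univ a)
      (Finset.mem_univ a') (mul_pos (hq a') hab') (fun x _ _ => hnonneg b x)
  rw [push_single, KL_single]
  calc KL (P a) (push P q) < ∑ c, P a c * -Real.log (q a) := by
        refine Finset.sum_lt_sum (fun c _ => ?_) ⟨b, Finset.mem_univ b, ?_⟩
        · rcases (hP.1 a c).eq_or_lt with h0 | h0
          · simp [← h0]
          · have hpos : 0 < push P q c := (mul_pos (hq a) h0).trans_le (hle c)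
            refine mul_le_mul_of_nonneg_left ?_ h0.le
            rw [← Real.log_inv]
            refine Real.log_le_log (div_pos h0 hpos) ?_
            rw [div_le_iff₀ hpos, inv_mul_eq_div, le_div_iff₀ (hq a), mul_comm]
            exact hle c
        · have hpos : 0 < push P q b := (mul_pos (hq a) hab).trans hlt
          refine mul_lt_mul_of_pos_left ?_ hab
          rw [← Real.log_inv]
          refine Real.log_lt_log (div_pos hab hpos) ?_
          rw [div_lt_iff₀ hpos, inv_mul_eq_div, lt_div_iff₀ (hq a), mul_comm]
          exact hlt
    _ = -Real.log (q a) := by rw [← Finset.sum_mul, hP.2, one_mul]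

/-- A kernel on a finite set whose rows have pairwise disjoint supports is a permutation kernel. -/
theorem IsKernel.exists_perm {X : Type*} [Fintype X] [DecidableEq X] {P : X → X → ℝ}
    (hP : IsKernel P) (h : ∀ a a' b, 0 < P a b → 0 < P a' b → a = a') :
    ∃ σ : Equiv.Perm X, ∀ x0 x1, P x0 x1 = if x1 = σ x0 then 1 else 0 := by
  have hex : ∀ a, ∃ b, 0 < P a b := by
    intro a
    obtain ⟨b, -, hb⟩ := Finset.exists_lt_of_sum_lt (s := Finset.univ) (f := fun _ : X => (0 : ℝ))
      (g := P a) (by simp [hP.2 a])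
    exact ⟨b, hb⟩
  choose f hf using hex
  have hinj : Function.Injective f := fun a a' haa =>
    h a a' (f a) (hf a) (by rw [haa]; exact hf a')
  have hbij : Function.Bijective f := Finite.injective_iff_bijective.mp hinj
  have hzero : ∀ a b, b ≠ f a → P a b = 0 := by
    intro a b hb
    by_contra hne
    obtain ⟨a', rfl⟩ := hbij.2 b
    exact hb (by rw [h a a' _ ((hP.1 _ _).lt_of_ne' hne) (hf a')])
  refine ⟨Equiv.ofBijective f hbij, fun a b => ?_⟩
  rw [Equiv.ofBijective_apply]
  split_ifs with hb
  · have hsum := hP.2 a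
    rw [Finset.sum_eq_single (f a) (fun c _ hc => hzero a c hc) (by simp)] at hsum
    rw [hb, hsum]
  · exact hzero a b hb

/-- For a full-support distribution `q`, there exists `r` with strictly
positive KL contraction iff `P` is not a permutation kernel; and permutation kernels
preserve KL divergence. -/
theorem kl_contraction_positive_iff_not_permutation {X : Type*} [Fintype X] [Nonempty X] [DecidableEq X]
    (P : X → X → ℝ) (hP : IsKernel P)
    (q : X → ℝ) (hq : IsProb q) (hqfull : ∀ x, 0 < q x) :
    ((∃ r : X → ℝ, IsProb r ∧ 0 < KL r q - KL (push P r) (push P q)) ↔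
        ¬ ∃ σ : Equiv.Perm X, ∀ x0 x1, P x0 x1 = if x1 = σ x0 then 1 else 0) ∧
      ((∃ σ : Equiv.Perm X, ∀ x0 x1, P x0 x1 = if x1 = σ x0 then 1 else 0) →
        ∀ r : X → ℝ, IsProb r → KL (push P r) (push P q) = KL r q) := by
  refine ⟨⟨?_, fun hperm => ?_⟩, fun ⟨σ, hσ⟩ r _ => KL_push_of_perm σ hσ r q⟩
  · rintro ⟨r, -, hr⟩ ⟨σ, hσ⟩
    rw [KL_push_of_perm σ hσ, sub_self] at hr
    exact lt_irrefl 0 hr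
  · by_contra hnone
    refine hperm (hP.exists_perm fun a a' b hab hab' => ?_)
    by_contra hne
    exact hnone ⟨Pi.single a 1, isProb_single a,
      sub_pos.mpr (KL_push_single_lt hP hqfull hne hab hab')⟩
end
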